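/- arXiv:1402.7258 — 3 statements merged into one kernel-verified Lean document; each statement's English description precedes it below -/
import Mathlib

section
/- For complex matrices H of size m×n and any subset selection: if H_{[k,n]} denotes H with all columns except k..n removed and H̄_{[k,n]} denotes H with columns k..n removed, then det(I - H_{[k,n]}^H (N₀ I + H H^H)^{-1} H_{[k,n]}) = det(I + H̄_{[k,n]} H̄_{[k,n]}^H / N₀) / det(I + H H^H / N₀) for N₀ > 0. -/
open Matrix

open scoped ComplexOrder in
lemma aux_isUnit (nR nT : ℕ) (H : Matrix (Fin nR) (Fin nT) ℂ) (N0 : ℝ) (hN0 : 0 < N0) :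
    IsUnit ((N0 : ℂ) • (1 : Matrix (Fin nR) (Fin nR) ℂ) + H * Hᴴ).det := by
  have hpos : ((N0 : ℂ) • (1 : Matrix (Fin nR) (Fin nR) ℂ) + H * Hᴴ).PosDef := by
    apply Matrix.PosDef.add_posSemidef
    · apply Matrix.PosDef.smul Matrix.PosDef.one
      exact_mod_cast hN0
    · exact Matrix.posSemidef_self_mul_conjTranspose H
  exact isUnit_iff_ne_zero.mpr (ne_of_gt hpos.det_pos)

/-- For an n_R × n_T complex matrix `H`, `N₀ > 0`, and any column selection `S`
(the paper takes `S` to be the columns k..n), with `H_S` the columns in `S` and `H̄_S` the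
remaining columns,
`det(I - H_Sᴴ (N₀ I + H Hᴴ)⁻¹ H_S) = det(I + H̄_S H̄_Sᴴ / N₀) / det(I + H Hᴴ / N₀)`. -/
theorem stmt0 (nR nT : ℕ) (H : Matrix (Fin nR) (Fin nT) ℂ) (N0 : ℝ) (hN0 : 0 < N0)
    (S : Finset (Fin nT)) :
    (1 - (H.submatrix id (Subtype.val : {j : Fin nT // j ∈ S} → Fin nT))ᴴ *
        ((N0 : ℂ) • 1 + H * Hᴴ)⁻¹ *
        (H.submatrix id (Subtype.val : {j : Fin nT // j ∈ S} → Fin nT))).det =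
      (1 + (N0 : ℂ)⁻¹ • ((H.submatrix id (Subtype.val : {j : Fin nT // j ∉ S} → Fin nT)) *
          (H.submatrix id (Subtype.val : {j : Fin nT // j ∉ S} → Fin nT))ᴴ)).det /
        (1 + (N0 : ℂ)⁻¹ • (H * Hᴴ)).det := by
  set A := H.submatrix id (Subtype.val : {j : Fin nT // j ∈ S} → Fin nT) with hA
  set B := H.submatrix id (Subtype.val : {j : Fin nT // j ∉ S} → Fin nT) with hB
  have hsplit : H * Hᴴ = A * Aᴴ + B * Bᴴ := by
    ext i j
    simp only [hA, hB, Matrix.mul_apply, Matrix.add_apply, Matrix.conjTranspose_apply,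
      Matrix.submatrix_apply, id]
    convert (Fintype.sum_subtype_add_sum_subtype (fun x => x ∈ S)
      (fun x => H i x * star (H j x))).symm
  have hN : (N0 : ℂ) ≠ 0 := by exact_mod_cast hN0.ne'
  set M := (N0 : ℂ) • (1 : Matrix (Fin nR) (Fin nR) ℂ) + H * Hᴴ with hM
  have hMu : IsUnit M.det := aux_isUnit nR nT H N0 hN0
  have hK : 1 + (N0 : ℂ)⁻¹ • (H * Hᴴ) = (N0 : ℂ)⁻¹ • M := by
    rw [hM, smul_add, smul_smul, inv_mul_cancel₀ hN, one_smul]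
  have hKd : (1 + (N0 : ℂ)⁻¹ • (H * Hᴴ)).det ≠ 0 := by
    rw [hK, Matrix.det_smul]
    exact mul_ne_zero (pow_ne_zero _ (inv_ne_zero hN)) hMu.ne_zero
  rw [eq_div_iff hKd, Matrix.mul_assoc, Matrix.det_one_sub_mul_comm, mul_comm, ← Matrix.det_mul]
  congr 1
  have h1 : M * (M⁻¹ * A * Aᴴ) = A * Aᴴ := by
    rw [Matrix.mul_assoc, Matrix.mul_nonsing_inv_cancel_left _ _ hMu]
  rw [Matrix.mul_sub, Matrix.mul_one]
  nth_rewrite 2 [hK]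
  rw [Matrix.smul_mul, h1, hsplit, smul_add]
  abel
end

section
/- Let H be an n_R × n_T complex matrix, N₀ > 0, and B = I - H^H (H H^H + N₀ I)^{-1} H. For K < n_T and K < k ≤ n_T, define d_k = det(B^{k-K}_{k-1}) / det(B^{k-K}_{k}), where B^i_j is the principal submatrix of B on indices i..j. Then d_k = det(I + Ḡ_{[k-K,k-1]}/N₀) / det(I + Ḡ_{[k-K,k]}/N₀), where Ḡ_{[a,b]} = H̄_{[a,b]} H̄_{[a,b]}^H and H̄_{[a,b]} is H with columns a..b deleted. -/
open Matrix

/-- The principal submatrix of `C` on the `L` consecutive indices starting at `a`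
(0-based); junk value `0` outside the valid range. -/
def psub {n : ℕ} (C : Matrix (Fin n) (Fin n) ℂ) (a L : ℕ) : Matrix (Fin L) (Fin L) ℂ :=
  fun i j =>
    if h : a + i.val < n ∧ a + j.val < n then C ⟨a + i.val, h.1⟩ ⟨a + j.val, h.2⟩ else 0

/-- `H̄_{[a,b]}`: the matrix `H` with columns `a, …, b` (1-based, inclusive) deleted. -/
def colDel {nR nT : ℕ} (H : Matrix (Fin nR) (Fin nT) ℂ) (a b : ℕ) :
    Matrix (Fin nR) {j : Fin nT // j.val + 1 < a ∨ b < j.val + 1} ℂ :=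
  H.submatrix id Subtype.val

lemma sum_split_aux {nT : ℕ} (a L : ℕ) (h : a + L ≤ nT) (f : Fin nT → ℂ) :
    ∑ j, f j = (∑ i : Fin L, f ⟨a + i.val, by have := i.isLt; omega⟩) +
      ∑ j : {j : Fin nT // j.val + 1 < a + 1 ∨ a + L < j.val + 1}, f j.val := by
  let g : Fin L ⊕ {j : Fin nT // j.val + 1 < a + 1 ∨ a + L < j.val + 1} → Fin nT :=
    Sum.elim (fun i => ⟨a + i.val, by have := i.isLt; omega⟩) Subtype.val
  have hg : Function.Bijective g := by
    constructor
    · rintro (⟨x, hx⟩ | ⟨⟨x, hx⟩, hx'⟩) (⟨y, hy⟩ | ⟨⟨y, hy⟩, hy'⟩) hxy <;>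
        simp only [g, Sum.elim_inl, Sum.elim_inr, Fin.mk.injEq] at hxy hx <;>
        simp <;> (try simp only at hx') <;> (try simp only at hy') <;> omega
    · intro j
      by_cases hj : j.val + 1 < a + 1 ∨ a + L < j.val + 1
      · exact ⟨Sum.inr ⟨j, hj⟩, rfl⟩
      · refine ⟨Sum.inl ⟨j.val - a, by omega⟩, ?_⟩
        ext
        simp only [g, Sum.elim_inl]
        omega
  rw [← hg.sum_comp f, Fintype.sum_sum_type]
  rfl

lemma det_psub_aux {nR nT : ℕ} (a L : ℕ) (h : a + L ≤ nT)
    (H : Matrix (Fin nR) (Fin nT) ℂ) (N0 : ℂ) (hN0 : N0 ≠ 0)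
    (M : Matrix (Fin nR) (Fin nR) ℂ) (hM : M = H * Hᴴ + N0 • 1) (hdet : IsUnit M.det) :
    (psub (1 - Hᴴ * M⁻¹ * H) a L).det =
      (M⁻¹.det * N0 ^ nR) *
        (1 + N0⁻¹ • (colDel H (a + 1) (a + L) * (colDel H (a + 1) (a + L))ᴴ)).det := by
  let e : Fin L → Fin nT := fun i => ⟨a + i.val, by have := i.isLt; omega⟩
  have he : Function.Injective e := by
    intro x y hxy
    simp only [e, Fin.mk.injEq] at hxy
    ext; omega
  let HS : Matrix (Fin nR) (Fin L) ℂ := H.submatrix id e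
  have h1 : psub (1 - Hᴴ * M⁻¹ * H) a L = 1 - HSᴴ * (M⁻¹ * HS) := by
    have h2 : psub (1 - Hᴴ * M⁻¹ * H) a L = (1 - Hᴴ * M⁻¹ * H).submatrix e e := by
      ext i j
      have hi := i.isLt
      have hj := j.isLt
      simp only [psub]
      rw [dif_pos ⟨by omega, by omega⟩]
      rfl
    rw [h2, Matrix.mul_assoc]
    have h3 : (1 : Matrix (Fin nT) (Fin nT) ℂ).submatrix e e = 1 := Matrix.submatrix_one e he
    rw [← h3]
    rfl
  have h4 : M - HS * HSᴴ =
      N0 • (1 + N0⁻¹ • (colDel H (a + 1) (a + L) * (colDel H (a + 1) (a + L))ᴴ)) := by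
    rw [smul_add, smul_smul, mul_inv_cancel₀ hN0, one_smul, hM]
    have h5 : H * Hᴴ = HS * HSᴴ + colDel H (a + 1) (a + L) * (colDel H (a + 1) (a + L))ᴴ := by
      ext x y
      simp only [Matrix.add_apply, Matrix.mul_apply]
      exact sum_split_aux a L h (fun j => H x j * Hᴴ j y)
    rw [h5]; abel
  have h6 : (1 - M⁻¹ * HS * HSᴴ) = M⁻¹ * (M - HS * HSᴴ) := by
    rw [Matrix.mul_sub, Matrix.nonsing_inv_mul M hdet, Matrix.mul_assoc]
  rw [h1, Matrix.det_one_sub_mul_comm, h6, Matrix.det_mul, h4, Matrix.det_smul, Fintype.card_fin,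
    mul_assoc]

open scoped ComplexOrder in
lemma isUnit_det_aux {nR nT : ℕ} (H : Matrix (Fin nR) (Fin nT) ℂ) (N0 : ℝ) (hN0 : 0 < N0) :
    IsUnit (H * Hᴴ + (N0 : ℂ) • (1 : Matrix (Fin nR) (Fin nR) ℂ)).det := by
  have hpd : (H * Hᴴ + (N0 : ℂ) • (1 : Matrix (Fin nR) (Fin nR) ℂ)).PosDef := by
    refine Matrix.PosDef.posSemidef_add (Matrix.posSemidef_self_mul_conjTranspose H) ?_
    exact Matrix.PosDef.one.smul (by exact_mod_cast hN0)
  exact (Matrix.isUnit_iff_isUnit_det _).1 hpd.isUnit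

/-- With `B = I - Hᴴ(H Hᴴ + N₀ I)⁻¹H` and `K < k ≤ n_T` (1-based),
`d_k = det(B^{k-K}_{k-1}) / det(B^{k-K}_{k})
     = det(I + Ḡ_{[k-K,k-1]}/N₀) / det(I + Ḡ_{[k-K,k]}/N₀)`
where `Ḡ_{[a,b]} = H̄_{[a,b]} H̄_{[a,b]}ᴴ`. -/
theorem stmt4 (nR nT K k : ℕ) (hKk : K < k) (hk : k ≤ nT)
    (H : Matrix (Fin nR) (Fin nT) ℂ) (N0 : ℝ) (hN0 : 0 < N0)
    (B : Matrix (Fin nT) (Fin nT) ℂ)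
    (hB : B = 1 - Hᴴ * (H * Hᴴ + (N0 : ℂ) • 1)⁻¹ * H) :
    (psub B (k - K - 1) K).det / (psub B (k - K - 1) (K + 1)).det =
      (1 + (N0 : ℂ)⁻¹ • (colDel H (k - K) (k - 1) * (colDel H (k - K) (k - 1))ᴴ)).det /
        (1 + (N0 : ℂ)⁻¹ • (colDel H (k - K) k * (colDel H (k - K) k)ᴴ)).det := by
  have hN : (N0 : ℂ) ≠ 0 := by exact_mod_cast hN0.ne'
  have hu := isUnit_det_aux H N0 hN0
  obtain ⟨a, rfl⟩ : ∃ a, k = a + 1 + K := ⟨k - K - 1, by omega⟩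
  have e1 : a + 1 + K - K - 1 = a := by omega
  have e2 : a + 1 + K - K = a + 1 := by omega
  have e3 : a + 1 + K - 1 = a + K := by omega
  have e4 : a + 1 + K = a + (K + 1) := by omega
  rw [e1, e2, e3, e4, hB, det_psub_aux a K (by omega) H _ hN _ rfl hu,
    det_psub_aux a (K + 1) (by omega) H _ hN _ rfl hu]
  refine mul_div_mul_left _ _ (mul_ne_zero ?_ (pow_ne_zero _ hN))
  exact ((Matrix.isUnit_nonsing_inv_det _ hu)).ne_zero
end

section
/- Let H be an n_R × n_T complex matrix and N₀ > 0, and let B = I - H^H(H H^H + N₀ I)^{-1} H. Then for 1 ≤ k ≤ n ≤ n_T, det(B^k_n) = det(I + H̄_{[k,n]} H̄_{[k,n]}^H / N₀) / det(I + H H^H / N₀), where B^k_n is the principal submatrix of B on indices k..n and H̄_{[k,n]} is H with columns k..n deleted. -/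
open Matrix

open scoped ComplexOrder in
theorem gram_add_det_ne_zero {nR nT : ℕ} (H : Matrix (Fin nR) (Fin nT) ℂ) (N0 : ℝ)
    (hN0 : 0 < N0) : (H * Hᴴ + (N0 : ℂ) • (1 : Matrix (Fin nR) (Fin nR) ℂ)).det ≠ 0 := by
  have hApd : (H * Hᴴ + (N0 : ℂ) • (1 : Matrix (Fin nR) (Fin nR) ℂ)).PosDef := by
    refine Matrix.PosDef.posSemidef_add (Matrix.posSemidef_self_mul_conjTranspose H) ?_
    exact Matrix.PosDef.one.smul (by exact_mod_cast hN0)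
  exact ne_of_gt hApd.det_pos

/-- With `B = I - Hᴴ(H Hᴴ + N₀ I)⁻¹H` and `1 ≤ k ≤ n ≤ n_T` (1-based),
`det(B^k_n) = det(I + H̄_{[k,n]} H̄_{[k,n]}ᴴ/N₀) / det(I + H Hᴴ/N₀)`,
where `B^k_n` is the principal submatrix of `B` on indices `k..n`. -/
theorem stmt5 (nR nT k n : ℕ) (hk : 1 ≤ k) (hkn : k ≤ n) (hn : n ≤ nT)
    (H : Matrix (Fin nR) (Fin nT) ℂ) (N0 : ℝ) (hN0 : 0 < N0)
    (B : Matrix (Fin nT) (Fin nT) ℂ)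
    (hB : B = 1 - Hᴴ * (H * Hᴴ + (N0 : ℂ) • 1)⁻¹ * H) :
    (psub B (k - 1) (n - k + 1)).det =
      (1 + (N0 : ℂ)⁻¹ • (colDel H k n * (colDel H k n)ᴴ)).det /
        (1 + (N0 : ℂ)⁻¹ • (H * Hᴴ)).det := by
  have hc : (N0 : ℂ) ≠ 0 := by exact_mod_cast ne_of_gt hN0
  have hlt : ∀ i : Fin (n - k + 1), k - 1 + i.val < nT := fun i => by omega
  let e : Fin (n - k + 1) → Fin nT := fun i => ⟨k - 1 + i.val, hlt i⟩
  have he : Function.Injective e := by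
    intro i j hij
    have := congrArg Fin.val hij
    simp only [e] at this
    apply Fin.ext
    omega
  let G : Matrix (Fin nR) (Fin (n - k + 1)) ℂ := H.submatrix id e
  -- `H Hᴴ` splits along the kept and the deleted columns
  have hsplit : H * Hᴴ = G * Gᴴ + colDel H k n * (colDel H k n)ᴴ := by
    ext a b
    simp only [Matrix.add_apply, Matrix.mul_apply, Matrix.conjTranspose_apply, G, colDel,
      Matrix.submatrix_apply, id]
    rw [← Fintype.sum_subtype_add_sum_subtype
      (fun j : Fin nT => j.val + 1 < k ∨ n < j.val + 1) (fun j => H a j * star (H b j)), add_comm]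
    congr 1
    symm
    refine Fintype.sum_bijective
      (fun i => (⟨e i, by simp only [e]; omega⟩ :
        {j : Fin nT // ¬ (j.val + 1 < k ∨ n < j.val + 1)})) ⟨?_, ?_⟩ _ _ (fun i => rfl)
    · intro i j hij
      exact he (congrArg Subtype.val hij)
    · rintro ⟨j, hj⟩
      refine ⟨⟨j.val - (k - 1), by omega⟩, ?_⟩
      apply Subtype.ext
      apply Fin.ext
      simp only [e]
      omega
  set A := H * Hᴴ + (N0 : ℂ) • (1 : Matrix (Fin nR) (Fin nR) ℂ) with hA
  have hdet : A.det ≠ 0 := gram_add_det_ne_zero H N0 hN0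
  have hunit : IsUnit A.det := isUnit_iff_ne_zero.mpr hdet
  have hpsub : psub B (k - 1) (n - k + 1) = 1 - Gᴴ * A⁻¹ * G := by
    have h1 : psub B (k - 1) (n - k + 1) = B.submatrix e e := by
      ext i j
      simp only [psub, Matrix.submatrix_apply, e]
      rw [dif_pos ⟨hlt i, hlt j⟩]
    rw [h1, hB, Matrix.submatrix_sub, Pi.sub_apply, Pi.sub_apply, Matrix.submatrix_one e he]
    rfl
  have h1 : A = (N0 : ℂ) • (1 + (N0 : ℂ)⁻¹ • (H * Hᴴ)) := by
    rw [smul_add, smul_smul, mul_inv_cancel₀ hc, one_smul, add_comm]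
  have h2 : A - G * Gᴴ = (N0 : ℂ) • (1 + (N0 : ℂ)⁻¹ • (colDel H k n * (colDel H k n)ᴴ)) := by
    rw [smul_add, smul_smul, mul_inv_cancel₀ hc, one_smul, hA, hsplit]
    abel
  have h3 : (1 - G * (Gᴴ * A⁻¹)) * A = A - G * Gᴴ := by
    rw [Matrix.sub_mul, Matrix.one_mul, Matrix.mul_assoc, Matrix.mul_assoc,
      Matrix.nonsing_inv_mul _ hunit, Matrix.mul_one]
  have h4 := congrArg Matrix.det h3
  rw [Matrix.det_mul, h2, Matrix.det_smul] at h4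
  have h5 := congrArg Matrix.det h1
  rw [Matrix.det_smul] at h5
  have hp : (N0 : ℂ) ^ Fintype.card (Fin nR) ≠ 0 := pow_ne_zero _ hc
  have hM : (1 + (N0 : ℂ)⁻¹ • (H * Hᴴ)).det ≠ 0 := by
    intro h
    rw [h, mul_zero] at h5
    exact hdet h5
  rw [hpsub, Matrix.det_one_sub_mul_comm, eq_div_iff hM]
  apply mul_left_cancel₀ hp
  rw [← h4, h5]
  ring
end
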